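/- The map ev : H(Q) → C defined on H_d by ev(f) = (#G_d)^{-1} Σ_{X∈R_d} f(X) is a twisted character: ev(f*g) = v^{−⟨e,d⟩} ev(f) ev(g) for f ∈ H_d, g ∈ H_e. -/

import Mathlib

set_option linter.unusedSectionVars false
set_option linter.unusedVariables false

open Matrix Module

variable (k : Type*) [Field k] [Fintype k] [DecidableEq k]
variable {I : Type*} [Fintype I] [DecidableEq I]
variable {Ar : Type*} [Fintype Ar] [DecidableEq Ar]

/-- The Euler form `⟨d,e⟩ = Σ_i d_i e_i - Σ_{a : i → j} d_i e_j` of the quiver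
with source/target maps `st`, `tg`. -/
def eulerForm (st tg : Ar → I) (d e : I → ℕ) : ℤ :=
  ∑ i, (d i : ℤ) * e i - ∑ a, (d (st a) : ℤ) * e (tg a)

/-- The variety `R_d` of representations of the quiver with dimension vector
`d` over `k`: a matrix for every arrow. -/
abbrev RepOf (st tg : Ar → I) (d : I → ℕ) : Type _ :=
  ∀ a : Ar, Matrix (Fin (d (tg a))) (Fin (d (st a))) k

variable {k}

/-- A family of submodules `U i ≤ k^{d i}` is a subrepresentation of
`X ∈ R_d` if it is stable under all the matrices of `X`. -/
def IsSub {st tg : Ar → I} {d : I → ℕ} (X : RepOf k st tg d)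
    (U : ∀ i, Submodule k (Fin (d i) → k)) : Prop :=
  ∀ a, ∀ x ∈ U (st a), (X a).mulVec x ∈ U (tg a)

theorem botIsSub {st tg : Ar → I} {d : I → ℕ} (X : RepOf k st tg d) :
    IsSub X (fun _ => ⊥) := by
  intro a x hx
  simp only [Submodule.mem_bot] at hx ⊢
  simp [hx]

theorem topIsSub {st tg : Ar → I} {d : I → ℕ} (X : RepOf k st tg d) :
    IsSub X (fun _ => ⊤) := fun _ _ _ => trivial

/-- The subquotient module `U/W`. -/
def sqMod {M : Type*} [AddCommGroup M] [Module k M]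
    (U W : Submodule k M) : Type _ :=
  ↥U ⧸ (W.comap U.subtype)

noncomputable instance {M : Type*} [AddCommGroup M] [Module k M] (U W : Submodule k M) :
    AddCommGroup (sqMod U W) := by unfold sqMod; infer_instance

noncomputable instance {M : Type*} [AddCommGroup M] [Module k M] (U W : Submodule k M) :
    Module k (sqMod U W) := by unfold sqMod; infer_instance

instance {M : Type*} [AddCommGroup M] [Module k M] [FiniteDimensional k M]
    (U W : Submodule k M) : FiniteDimensional k (sqMod U W) := by
  unfold sqMod; infer_instance

/-- A chosen identification of a finite-dimensional space with the standard
coordinate space of its dimension. -/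
noncomputable def stdEquiv (M : Type*) [AddCommGroup M] [Module k M]
    [FiniteDimensional k M] : M ≃ₗ[k] (Fin (finrank k M) → k) :=
  (Module.finBasis k M).equivFun

/-- The linear map induced on subquotients by an arrow of `X`. -/
noncomputable def sqMap {st tg : Ar → I} {d : I → ℕ} (X : RepOf k st tg d)
    (W U : ∀ i, Submodule k (Fin (d i) → k))
    (hU : IsSub X U) (hW : IsSub X W) (hWU : ∀ i, W i ≤ U i) (a : Ar) :
    sqMod (U (st a)) (W (st a)) →ₗ[k] sqMod (U (tg a)) (W (tg a)) :=
  Submodule.mapQ _ _ (((X a).mulVecLin).restrict (hU a))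
    (by
      intro x hx
      exact hW a (x : Fin (d (st a)) → k) hx)

/-- The subquotient representation: the representation of dimension vector
`i ↦ dim (U i / W i)` obtained from a pair of subrepresentations `W ≤ U` of
`X`, written in chosen bases. -/
noncomputable def subqRep {st tg : Ar → I} {d : I → ℕ} (X : RepOf k st tg d)
    (W U : ∀ i, Submodule k (Fin (d i) → k))
    (hU : IsSub X U) (hW : IsSub X W) (hWU : ∀ i, W i ≤ U i) :
    RepOf k st tg (fun i => finrank k (sqMod (U i) (W i))) :=
  fun a => LinearMap.toMatrix'
    (((stdEquiv (sqMod (U (tg a)) (W (tg a)))).toLinearMap.comp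
        (sqMap X W U hU hW hWU a)).comp
      (stdEquiv (sqMod (U (st a)) (W (st a)))).symm.toLinearMap)

/-- The (completed) Hall algebra of the quiver as a module: families of
`ℂ`-valued functions on the spaces `R_d`, for all dimension vectors `d`. -/
def HallAlg (k : Type*) [Field k] {I : Type*} [Fintype I] {Ar : Type*}
    (st tg : Ar → I) : Type _ :=
  ∀ d : I → ℕ, RepOf k st tg d → ℂ

/-- The unit of the Hall algebra: the characteristic function of the zero
representation. -/
noncomputable def hallOne {st tg : Ar → I} : HallAlg k st tg :=
  fun d _ => if d = 0 then 1 else 0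

/-- The Hall product: for `f` of degree `d'` and `g` of degree `e`,
`(f * g)(X) = v^{⟨e,d'⟩} Σ_{U ⊆ X} f(U) g(X/U)`, summed over all
subrepresentations `U` of `X`; here written degreewise on the completed Hall
algebra. -/
noncomputable def hallMul {st tg : Ar → I} (v : ℝ) (f g : HallAlg k st tg) :
    HallAlg k st tg :=
  fun d X =>
    ∑ᶠ U : {U : ∀ i, Submodule k (Fin (d i) → k) // IsSub X U},
      ((v : ℂ) ^
        (eulerForm st tg (fun i => finrank k (sqMod (⊤ : Submodule k (Fin (d i) → k)) (U.1 i)))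
          (fun i => finrank k (sqMod (U.1 i) (⊥ : Submodule k (Fin (d i) → k)))))) *
      (f (fun i => finrank k (sqMod (U.1 i) (⊥ : Submodule k (Fin (d i) → k))))
          (subqRep X (fun _ => ⊥) U.1 U.2 (botIsSub X) (fun i => bot_le)) *
        g (fun i => finrank k (sqMod (⊤ : Submodule k (Fin (d i) → k)) (U.1 i)))
          (subqRep X U.1 (fun _ => ⊤) (topIsSub X) U.2 (fun i => le_top)))

/-- The iterated Hall product `f 0 * f 1 * ⋯ * f (n-1)`. -/
noncomputable def hallProd {st tg : Ar → I} (v : ℝ) {n : ℕ}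
    (f : Fin n → HallAlg k st tg) : HallAlg k st tg :=
  (List.ofFn f).foldr (hallMul v) hallOne

/-- The base-change action of `G_d = Π_i GL_{d_i}(k)` on `R_d`. -/
def gAct {st tg : Ar → I} {d : I → ℕ} (g : ∀ i, GL (Fin (d i)) k)
    (X : RepOf k st tg d) : RepOf k st tg d :=
  fun a => (g (tg a) : Matrix (Fin (d (tg a))) (Fin (d (tg a))) k) * X a *
    (((g (st a))⁻¹ : GL (Fin (d (st a))) k) : Matrix (Fin (d (st a))) (Fin (d (st a))) k)

/-- The evaluation map on the degree-`d` part of the Hall algebra: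
`ev(f) = (#G_d)⁻¹ Σ_{X ∈ R_d} f(X)`. -/
noncomputable def evHall {st tg : Ar → I} (d : I → ℕ) (f : HallAlg k st tg) : ℂ :=
  ((Nat.card (∀ i, GL (Fin (d i)) k) : ℂ))⁻¹ * ∑ X : RepOf k st tg d, f d X

theorem finsum_subtype_eq_sum_dite {α M : Type*} [Fintype α] [AddCommMonoid M] (p : α → Prop)
    [DecidablePred p] (F : ∀ a, p a → M) :
    ∑ᶠ a : {a // p a}, F a.1 a.2 = ∑ a, if h : p a then F a h else 0 := by
  rw [finsum_eq_sum_of_fintype, ← Fintype.sum_subtype_add_sum_subtype p,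
    Finset.sum_eq_zero (s := (Finset.univ : Finset {a // ¬ p a})) fun a _ => dif_neg a.2, add_zero]
  exact Finset.sum_congr rfl fun a _ => (dif_pos a.2).symm

section LinearEquivCounting

variable {A B V : Type*} [AddCommGroup A] [Module k A] [AddCommGroup B] [Module k B]
  [AddCommGroup V] [Module k V]

theorem finite_linearEquiv [Finite A] [Finite B] : Finite (A ≃ₗ[k] B) :=
  DFunLike.finite _

theorem card_linearEquiv_self (m : ℕ) :
    Nat.card ((Fin m → k) ≃ₗ[k] (Fin m → k)) = Nat.card (GL (Fin m) k) :=
  Nat.card_congr ((LinearMap.GeneralLinearGroup.generalLinearEquiv k _).symm.toEquiv.trans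
    Matrix.GeneralLinearGroup.toLin.symm.toEquiv)

theorem skewProd_map_range_inr (p : (B ≃ₗ[k] B) × (A ≃ₗ[k] A) × (B →ₗ[k] A)) :
    (LinearMap.range (LinearMap.inr k B A)).map (p.1.skewProd p.2.1 p.2.2).toLinearMap =
      LinearMap.range (LinearMap.inr k B A) := by
  ext ⟨x, y⟩
  simp only [Submodule.mem_map, LinearMap.mem_range, LinearMap.inr_apply]
  constructor
  · rintro ⟨_, ⟨z, rfl⟩, h⟩
    simp only [LinearEquiv.coe_coe, LinearEquiv.skewProd_apply, map_zero, add_zero,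
      Prod.mk.injEq] at h
    exact ⟨p.2.1 z, by simp [h.1, h.2]⟩
  · rintro ⟨z, h⟩
    refine ⟨_, ⟨p.2.1.symm z, rfl⟩, ?_⟩
    simpa using h

/-- The automorphisms of `B × A` that preserve `A` are the block triangular ones. -/
theorem card_stabilizer_range_inr [FiniteDimensional k A] [FiniteDimensional k B] :
    Nat.card {h : (B × A) ≃ₗ[k] (B × A) //
        (LinearMap.range (LinearMap.inr k B A)).map h.toLinearMap =
          LinearMap.range (LinearMap.inr k B A)} =
      Nat.card (B ≃ₗ[k] B) * (Nat.card (A ≃ₗ[k] A) * Nat.card (B →ₗ[k] A)) := by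
  rw [← Nat.card_prod, ← Nat.card_prod]
  symm
  refine Nat.card_eq_of_bijective
    (fun p => ⟨p.1.skewProd p.2.1 p.2.2, skewProd_map_range_inr p⟩) ⟨?_, ?_⟩
  · rintro ⟨β, α, γ⟩ ⟨β', α', γ'⟩ h
    have h' : ∀ x y, (β x, α y + γ x) = (β' x, α' y + γ' x) := fun x y => by
      simpa using DFunLike.congr_fun (Subtype.ext_iff.mp h) (x, y)
    simp only [Prod.mk.injEq] at h' ⊢
    refine ⟨LinearEquiv.ext fun x => (h' x 0).1, LinearEquiv.ext fun y => ?_,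
      LinearMap.ext fun x => ?_⟩
    · simpa using (h' 0 y).2
    · simpa using (h' x 0).2
  · rintro ⟨h, hh⟩
    have hA : ∀ y, (h (0, y)).1 = 0 := fun y => by
      have : h (0, y) ∈ LinearMap.range (LinearMap.inr k B A) := by
        rw [← hh]; exact ⟨(0, y), ⟨y, rfl⟩, rfl⟩
      obtain ⟨z, hz⟩ := this
      rw [← hz]; rfl
    have hα : Function.Injective ((LinearMap.snd k B A ∘ₗ h.toLinearMap) ∘ₗ
        LinearMap.inr k B A) := by
      rw [injective_iff_map_eq_zero]
      intro y hy
      have : h (0, y) = 0 := Prod.ext (hA y) hy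
      simpa using this
    have hβ : Function.Injective ((LinearMap.fst k B A ∘ₗ h.toLinearMap) ∘ₗ
        LinearMap.inl k B A) := by
      rw [injective_iff_map_eq_zero]
      intro x hx
      have : h (x, 0) ∈ (LinearMap.range (LinearMap.inr k B A)).map h.toLinearMap := by
        rw [hh]; exact ⟨(h (x, 0)).2, Prod.ext hx.symm rfl⟩
      obtain ⟨_, ⟨z, rfl⟩, hz⟩ := this
      exact (congrArg Prod.fst (h.injective hz)).symm
    refine ⟨⟨LinearEquiv.ofInjectiveEndo _ hβ, LinearEquiv.ofInjectiveEndo _ hα,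
      (LinearMap.snd k B A ∘ₗ h.toLinearMap) ∘ₗ LinearMap.inl k B A⟩, ?_⟩
    refine Subtype.ext (LinearEquiv.ext ?_)
    rintro ⟨x, y⟩
    have hxy : h (x, y) = h (x, 0) + h (0, y) := by rw [← map_add]; simp
    simp only [LinearEquiv.skewProd_apply, LinearEquiv.coe_ofInjectiveEndo]
    refine Prod.ext ?_ ?_
    · simp [hxy, hA]
    · simp [hxy, add_comm]

theorem card_linearEquiv_map_range_inr [FiniteDimensional k A] [FiniteDimensional k B]
    {W : Submodule k V} (θ : (B × A) ≃ₗ[k] V)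
    (hθ : (LinearMap.range (LinearMap.inr k B A)).map θ.toLinearMap = W) :
    Nat.card {h : (B × A) ≃ₗ[k] V //
        (LinearMap.range (LinearMap.inr k B A)).map h.toLinearMap = W} =
      Nat.card (B ≃ₗ[k] B) * (Nat.card (A ≃ₗ[k] A) * Nat.card (B →ₗ[k] A)) := by
  rw [← card_stabilizer_range_inr]
  symm
  refine Nat.card_congr (Equiv.subtypeEquiv
    ⟨fun h => h.trans θ, fun h => h.trans θ.symm, fun h => ?_, fun h => ?_⟩ fun h => ?_)
  · ext x <;> simp
  · ext x; simp
  · subst hθ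
    simp only [Equiv.coe_fn_mk, LinearEquiv.coe_trans, Submodule.map_comp]
    exact (Submodule.map_injective_of_injective θ.injective).eq_iff.symm

theorem exists_linearEquiv_map_range_inr [FiniteDimensional k A] [FiniteDimensional k B]
    [FiniteDimensional k V] (W : Submodule k V)
    (hA : finrank k (sqMod W (⊥ : Submodule k V)) = finrank k A)
    (hB : finrank k (sqMod (⊤ : Submodule k V) W) = finrank k B) :
    ∃ θ : (B × A) ≃ₗ[k] V,
      (LinearMap.range (LinearMap.inr k B A)).map θ.toLinearMap = W := by
  obtain ⟨C, hC⟩ := W.exists_isCompl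
  have hWA : finrank k W = finrank k A := by
    rw [← hA]
    have : (⊥ : Submodule k V).comap W.subtype = ⊥ := by simp
    exact (Submodule.quotEquivOfEqBot _ this).finrank_eq.symm
  have hCB : finrank k C = finrank k B := by
    rw [← hB]
    have h1 := Submodule.finrank_quotient_add_finrank
      (W.comap (⊤ : Submodule k V).subtype)
    have h2 : finrank k (W.comap (⊤ : Submodule k V).subtype) = finrank k W :=
      (Submodule.comapSubtypeEquivOfLe le_top).finrank_eq
    have h3 := Submodule.finrank_add_eq_of_isCompl hC
    rw [finrank_top] at h1
    change _ = finrank k (↥(⊤ : Submodule k V) ⧸ W.comap (⊤ : Submodule k V).subtype)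
    omega
  let α : A ≃ₗ[k] W := LinearEquiv.ofFinrankEq _ _ hWA.symm
  let β : B ≃ₗ[k] C := LinearEquiv.ofFinrankEq _ _ hCB.symm
  refine ⟨(β.prodCongr α).trans (Submodule.prodEquivOfIsCompl C W hC.symm), ?_⟩
  ext x
  simp only [Submodule.mem_map, LinearMap.mem_range]
  constructor
  · rintro ⟨_, ⟨z, rfl⟩, rfl⟩
    simp
  · intro hx
    exact ⟨_, ⟨α.symm ⟨x, hx⟩, rfl⟩, by simp⟩

end LinearEquivCounting

section Representations

variable {st tg : Ar → I}

/-- An invariant homogeneous function takes the same value on isomorphic representations. -/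
theorem HallAlg.apply_eq_of_iso {d : I → ℕ} {f : HallAlg k st tg}
    (hf : ∀ (gg : ∀ i, GL (Fin (d i)) k) (Y : RepOf k st tg d), f d (gAct gg Y) = f d Y)
    {d' : I → ℕ} (Y : RepOf k st tg d) (Y' : RepOf k st tg d')
    (ψ : ∀ i, (Fin (d i) → k) ≃ₗ[k] (Fin (d' i) → k))
    (h : ∀ a y, ψ (tg a) (Y a *ᵥ y) = Y' a *ᵥ ψ (st a) y) :
    f d' Y' = f d Y := by
  obtain rfl : d' = d := funext fun i => by simpa using (ψ i).finrank_eq.symm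
  let gg : ∀ i, GL (Fin (d' i)) k := fun i =>
    ⟨LinearMap.toMatrix' (ψ i).toLinearMap, LinearMap.toMatrix' (ψ i).symm.toLinearMap,
      by rw [← LinearMap.toMatrix'_comp]; simp, by rw [← LinearMap.toMatrix'_comp]; simp⟩
  rw [← hf gg Y]
  congr 1
  funext a
  refine Matrix.toLin'.injective (LinearMap.ext fun y => ?_)
  change Y' a *ᵥ y = (LinearMap.toMatrix' (ψ (tg a)).toLinearMap * Y a *
    LinearMap.toMatrix' (ψ (st a)).symm.toLinearMap) *ᵥ y
  rw [← Matrix.mulVec_mulVec, ← Matrix.mulVec_mulVec, LinearMap.toMatrix'_mulVec,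
    LinearMap.toMatrix'_mulVec]
  simp [h]

theorem subqRep_mulVec_stdEquiv {n : I → ℕ} (X : RepOf k st tg n)
    (W U : ∀ i, Submodule k (Fin (n i) → k))
    (hU : IsSub X U) (hW : IsSub X W) (hWU : ∀ i, W i ≤ U i) (a : Ar)
    (y : sqMod (U (st a)) (W (st a))) :
    subqRep X W U hU hW hWU a *ᵥ stdEquiv _ y = stdEquiv _ (sqMap X W U hU hW hWU a y) := by
  rw [subqRep, LinearMap.toMatrix'_mulVec]
  simp

variable {d e n : I → ℕ}

/-- The data of a block triangular representation: quotient, sub, and off-diagonal part. -/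
abbrev BlockRep (k : Type*) [Field k] (st tg : Ar → I) (d e : I → ℕ) : Type _ :=
  RepOf k st tg e × RepOf k st tg d × ∀ a : Ar, Matrix (Fin (d (tg a))) (Fin (e (st a))) k

/-- A family of identifications of `k^e × k^d` with `k^n`. -/
abbrev Framing (k : Type*) [Field k] (d e n : I → ℕ) : Type _ :=
  ∀ i, ((Fin (e i) → k) × (Fin (d i) → k)) ≃ₗ[k] (Fin (n i) → k)

/-- The images of the subspaces `k^d` under a framing. -/
def Framing.sub (θ : Framing k d e n) (i : I) : Submodule k (Fin (n i) → k) :=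
  (LinearMap.range (LinearMap.inr k (Fin (e i) → k) (Fin (d i) → k))).map (θ i).toLinearMap

theorem Framing.mem_sub (θ : Framing k d e n) (i : I) (x : Fin (e i) → k)
    (y : Fin (d i) → k) : θ i (x, y) ∈ θ.sub i ↔ x = 0 := by
  constructor
  · rintro ⟨_, ⟨z, rfl⟩, h⟩
    exact (congrArg Prod.fst ((θ i).injective h)).symm
  · rintro rfl
    exact ⟨(0, y), ⟨y, rfl⟩, rfl⟩

/-- The linear maps underlying a block triangular representation. -/
noncomputable def BlockRep.lin (P : BlockRep k st tg d e) (a : Ar) :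
    ((Fin (e (st a)) → k) × (Fin (d (st a)) → k)) →ₗ[k]
      ((Fin (e (tg a)) → k) × (Fin (d (tg a)) → k)) :=
  ((P.1 a).mulVecLin ∘ₗ LinearMap.fst k _ _).prod
    ((P.2.2 a).mulVecLin ∘ₗ LinearMap.fst k _ _ + (P.2.1 a).mulVecLin ∘ₗ LinearMap.snd k _ _)

/-- The representation on `k^n` obtained from a block triangular one along a framing. -/
noncomputable def Framing.rep (θ : Framing k d e n) (P : BlockRep k st tg d e) :
    RepOf k st tg n := fun a =>
  LinearMap.toMatrix' ((θ (tg a)).toLinearMap ∘ₗ P.lin a ∘ₗ (θ (st a)).symm.toLinearMap)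

theorem Framing.rep_mulVec (θ : Framing k d e n) (P : BlockRep k st tg d e) (a : Ar)
    (x : Fin (e (st a)) → k) (y : Fin (d (st a)) → k) :
    θ.rep P a *ᵥ θ (st a) (x, y) =
      θ (tg a) (P.1 a *ᵥ x, P.2.2 a *ᵥ x + P.2.1 a *ᵥ y) := by
  rw [Framing.rep, LinearMap.toMatrix'_mulVec]
  simp [BlockRep.lin]

theorem Framing.isSub_rep (θ : Framing k d e n) (P : BlockRep k st tg d e) :
    IsSub (θ.rep P) θ.sub := by
  intro a z hz
  obtain ⟨⟨x, y⟩, rfl⟩ := (θ (st a)).surjective z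
  obtain rfl := (θ.mem_sub _ _ _).mp hz
  rw [θ.rep_mulVec, θ.mem_sub]
  simp

theorem Framing.rep_bijective (θ : Framing k d e n) :
    Function.Bijective (fun P : BlockRep k st tg d e =>
      (⟨θ.rep P, θ.isSub_rep P⟩ : {X : RepOf k st tg n // IsSub X θ.sub})) := by
  constructor
  · intro P Q h
    have h' : ∀ a x y, (P.1 a *ᵥ x, P.2.2 a *ᵥ x + P.2.1 a *ᵥ y) =
        (Q.1 a *ᵥ x, Q.2.2 a *ᵥ x + Q.2.1 a *ᵥ y) := fun a x y => by
      apply (θ (tg a)).injective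
      rw [← θ.rep_mulVec, ← θ.rep_mulVec, show θ.rep P = θ.rep Q from Subtype.ext_iff.mp h]
    simp only [Prod.mk.injEq] at h'
    refine Prod.ext (funext fun a => ?_) (Prod.ext (funext fun a => ?_) (funext fun a => ?_)) <;>
      refine Matrix.toLin'.injective (LinearMap.ext fun y => ?_) <;>
      simp only [Matrix.toLin'_apply]
    · exact (h' a y 0).1
    · simpa using (h' a 0 y).2
    · simpa using (h' a y 0).2
  · rintro ⟨X, hX⟩
    let L := fun a => (θ (tg a)).symm.toLinearMap ∘ₗ (X a).mulVecLin ∘ₗ (θ (st a)).toLinearMap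
    have hL : ∀ a y, (L a (0, y)).1 = 0 := fun a y => by
      have := hX a (θ (st a) (0, y)) ((θ.mem_sub _ _ _).mpr rfl)
      rwa [← (θ (tg a)).apply_symm_apply (X a *ᵥ _), ← Prod.mk.eta (p := (θ (tg a)).symm _),
        θ.mem_sub] at this
    refine ⟨⟨fun a => LinearMap.toMatrix' (LinearMap.fst k _ _ ∘ₗ L a ∘ₗ LinearMap.inl k _ _),
      fun a => LinearMap.toMatrix' (LinearMap.snd k _ _ ∘ₗ L a ∘ₗ LinearMap.inr k _ _),
      fun a => LinearMap.toMatrix' (LinearMap.snd k _ _ ∘ₗ L a ∘ₗ LinearMap.inl k _ _)⟩,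
      Subtype.ext (funext fun a => Matrix.toLin'.injective (LinearMap.ext fun z => ?_))⟩
    obtain ⟨⟨x, y⟩, rfl⟩ := (θ (st a)).surjective z
    simp only [Matrix.toLin'_apply]
    rw [θ.rep_mulVec, ← LinearEquiv.eq_symm_apply]
    have hxy : (θ (tg a)).symm (X a *ᵥ θ (st a) (x, y)) = L a (x, 0) + L a (0, y) := by
      rw [← map_add]; simp [L]
    rw [hxy]
    simp only [LinearMap.toMatrix'_mulVec]
    refine Prod.ext ?_ ?_
    · simp [hL]
    · simp

/-- A framing identifies `k^d` with the framed subspace. -/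
noncomputable def Framing.subEquiv (θ : Framing k d e n) (i : I) :
    (Fin (d i) → k) ≃ₗ[k] sqMod (θ.sub i) (⊥ : Submodule k (Fin (n i) → k)) :=
  LinearEquiv.ofBijective
    (Submodule.mkQ ((⊥ : Submodule k (Fin (n i) → k)).comap (θ.sub i).subtype) ∘ₗ
      LinearMap.codRestrict (θ.sub i) ((θ i).toLinearMap ∘ₗ LinearMap.inr k _ _)
        (fun y => (θ.mem_sub i 0 y).mpr rfl)) (by
    constructor
    · refine (injective_iff_map_eq_zero _).mpr fun y hy => ?_
      have : θ i (0, y) = 0 := (Submodule.Quotient.mk_eq_zero _).mp hy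
      simpa using this
    · intro z
      obtain ⟨⟨w, hw⟩, rfl⟩ := Submodule.Quotient.mk_surjective _ z
      obtain ⟨⟨x, y⟩, rfl⟩ := (θ i).surjective w
      obtain rfl := (θ.mem_sub _ _ _).mp hw
      exact ⟨y, rfl⟩)

/-- A framing identifies `k^e` with the quotient by the framed subspace. -/
noncomputable def Framing.quotEquiv (θ : Framing k d e n) (i : I) :
    (Fin (e i) → k) ≃ₗ[k] sqMod (⊤ : Submodule k (Fin (n i) → k)) (θ.sub i) :=
  LinearEquiv.ofBijective
    (Submodule.mkQ ((θ.sub i).comap (⊤ : Submodule k (Fin (n i) → k)).subtype) ∘ₗ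
      LinearMap.codRestrict ⊤ ((θ i).toLinearMap ∘ₗ LinearMap.inl k _ _)
        (fun _ => trivial)) (by
    constructor
    · refine (injective_iff_map_eq_zero _).mpr fun x hx => ?_
      have := (Submodule.Quotient.mk_eq_zero _).mp hx
      exact (θ.mem_sub i x 0).mp this
    · intro z
      obtain ⟨⟨w, hw⟩, rfl⟩ := Submodule.Quotient.mk_surjective _ z
      obtain ⟨⟨x, y⟩, rfl⟩ := (θ i).surjective w
      refine ⟨x, (Submodule.Quotient.eq _).mpr ?_⟩
      change θ i (x, 0) - θ i (x, y) ∈ θ.sub i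
      rw [← map_sub]
      exact (θ.mem_sub i _ _).mpr (sub_self x))

theorem Framing.subEquiv_intertwines (θ : Framing k d e n) (P : BlockRep k st tg d e) (a : Ar)
    (y : Fin (d (st a)) → k) :
    θ.subEquiv (tg a) (P.2.1 a *ᵥ y) =
      sqMap (θ.rep P) (fun _ => ⊥) θ.sub (θ.isSub_rep P) (botIsSub _) (fun _ => bot_le) a
        (θ.subEquiv (st a) y) := by
  refine congrArg (Submodule.Quotient.mk (p := (⊥ : Submodule k (Fin (n (tg a)) → k)).comap
    (θ.sub (tg a)).subtype)) (Subtype.ext ?_)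
  change θ (tg a) (0, _) = θ.rep P a *ᵥ θ (st a) (0, y)
  rw [θ.rep_mulVec]
  simp

theorem Framing.quotEquiv_intertwines (θ : Framing k d e n) (P : BlockRep k st tg d e) (a : Ar)
    (x : Fin (e (st a)) → k) :
    θ.quotEquiv (tg a) (P.1 a *ᵥ x) =
      sqMap (θ.rep P) θ.sub (fun _ => ⊤) (topIsSub _) (θ.isSub_rep P) (fun _ => le_top) a
        (θ.quotEquiv (st a) x) := by
  refine (Submodule.Quotient.eq ((θ.sub (tg a)).comap
    (⊤ : Submodule k (Fin (n (tg a)) → k)).subtype)).mpr ?_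
  change θ (tg a) (P.1 a *ᵥ x, 0) - θ.rep P a *ᵥ θ (st a) (x, 0) ∈ θ.sub (tg a)
  rw [θ.rep_mulVec, ← map_sub]
  exact (θ.mem_sub _ _ _).mpr (sub_self _)

/-- The contribution of the subrepresentation `U` to the Hall product at `X`. -/
noncomputable def hallTerm (v : ℝ) (f g : HallAlg k st tg) (X : RepOf k st tg n)
    (U : ∀ i, Submodule k (Fin (n i) → k)) (hU : IsSub X U) : ℂ :=
  ((v : ℂ) ^
    (eulerForm st tg (fun i => finrank k (sqMod (⊤ : Submodule k (Fin (n i) → k)) (U i)))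
      (fun i => finrank k (sqMod (U i) (⊥ : Submodule k (Fin (n i) → k)))))) *
  (f (fun i => finrank k (sqMod (U i) (⊥ : Submodule k (Fin (n i) → k))))
      (subqRep X (fun _ => ⊥) U hU (botIsSub X) (fun i => bot_le)) *
    g (fun i => finrank k (sqMod (⊤ : Submodule k (Fin (n i) → k)) (U i)))
      (subqRep X U (fun _ => ⊤) (topIsSub X) hU (fun i => le_top)))

theorem hallTerm_framing (v : ℝ) {f g : HallAlg k st tg}
    (hf : ∀ (gg : ∀ i, GL (Fin (d i)) k) (Y : RepOf k st tg d), f d (gAct gg Y) = f d Y)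
    (hg : ∀ (gg : ∀ i, GL (Fin (e i)) k) (Y : RepOf k st tg e), g e (gAct gg Y) = g e Y)
    (θ : Framing k d e n) (P : BlockRep k st tg d e) :
    hallTerm v f g (θ.rep P) θ.sub (θ.isSub_rep P) =
      (v : ℂ) ^ eulerForm st tg e d * (f d P.2.1 * g e P.1) := by
  rw [hallTerm, HallAlg.apply_eq_of_iso hf P.2.1 _
      (fun i => (θ.subEquiv i).trans (stdEquiv _)) fun a y => ?_,
    HallAlg.apply_eq_of_iso hg P.1 _
      (fun i => (θ.quotEquiv i).trans (stdEquiv _)) fun a y => ?_]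
  · have h1 : (fun i => finrank k (sqMod (⊤ : Submodule k (Fin (n i) → k)) (θ.sub i))) = e :=
      funext fun i => by simpa using (θ.quotEquiv i).finrank_eq.symm
    have h2 : (fun i => finrank k (sqMod (θ.sub i) (⊥ : Submodule k (Fin (n i) → k)))) = d :=
      funext fun i => by simpa using (θ.subEquiv i).finrank_eq.symm
    rw [h1, h2]
  · simp only [LinearEquiv.trans_apply]
    rw [subqRep_mulVec_stdEquiv, θ.quotEquiv_intertwines]
  · simp only [LinearEquiv.trans_apply]
    rw [subqRep_mulVec_stdEquiv, θ.subEquiv_intertwines]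

theorem exists_framing_of_hallTerm_ne_zero {v : ℝ} {f g : HallAlg k st tg}
    (hf : ∀ d' : I → ℕ, d' ≠ d → f d' = 0) (hg : ∀ d' : I → ℕ, d' ≠ e → g d' = 0)
    {X : RepOf k st tg n} {U : ∀ i, Submodule k (Fin (n i) → k)} {hU : IsSub X U}
    (h : hallTerm v f g X U hU ≠ 0) : ∃ θ : Framing k d e n, θ.sub = U := by
  have h1 : (fun i => finrank k (sqMod (U i) (⊥ : Submodule k (Fin (n i) → k)))) = d := by
    by_contra hne
    exact h (by rw [hallTerm, hf _ hne]; simp)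
  have h2 : (fun i => finrank k (sqMod (⊤ : Submodule k (Fin (n i) → k)) (U i))) = e := by
    by_contra hne
    exact h (by rw [hallTerm, hg _ hne]; simp)
  choose θ hθ using fun i => exists_linearEquiv_map_range_inr
    (A := Fin (d i) → k) (B := Fin (e i) → k) (U i)
    (by simpa using congrFun h1 i) (by simpa using congrFun h2 i)
  exact ⟨θ, funext hθ⟩

theorem sum_hallTerm_framing (v : ℝ) {f g : HallAlg k st tg}
    (hf : ∀ (gg : ∀ i, GL (Fin (d i)) k) (Y : RepOf k st tg d), f d (gAct gg Y) = f d Y)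
    (hg : ∀ (gg : ∀ i, GL (Fin (e i)) k) (Y : RepOf k st tg e), g e (gAct gg Y) = g e Y)
    (θ : Framing k d e n) :
    ∑ᶠ X : {X : RepOf k st tg n // IsSub X θ.sub}, hallTerm v f g X.1 θ.sub X.2 =
      (v : ℂ) ^ eulerForm st tg e d *
        ((Fintype.card k : ℂ) ^ (∑ a, e (st a) * d (tg a)) *
          ((∑ Y, f d Y) * ∑ Z, g e Z)) := by
  rw [← finsum_comp_equiv (Equiv.ofBijective _ θ.rep_bijective)]
  simp only [Equiv.ofBijective_apply, hallTerm_framing v hf hg]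
  rw [finsum_eq_sum_of_fintype, ← Finset.mul_sum]
  congr 1
  rw [Fintype.sum_prod_type]
  simp only [Fintype.sum_prod_type, Finset.sum_const, nsmul_eq_mul, Finset.card_univ]
  have hc : Fintype.card (∀ a : Ar, Matrix (Fin (d (tg a))) (Fin (e (st a))) k) =
      Fintype.card k ^ (∑ a, e (st a) * d (tg a)) := by
    rw [Fintype.card_pi, ← Finset.prod_pow_eq_pow_sum]
    refine Finset.prod_congr rfl fun a _ => ?_
    rw [← Nat.card_eq_fintype_card, ← Nat.card_eq_fintype_card, Matrix, Nat.card_fun, Nat.card_fun]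
    simp [← pow_mul]
  rw [hc, Finset.sum_mul_sum, Finset.sum_comm, Finset.mul_sum]
  push_cast
  simp only [Finset.mul_sum]

theorem card_framing (h : n = d + e) :
    Nat.card (Framing k d e n) = Nat.card (∀ i, GL (Fin (n i)) k) := by
  rw [Nat.card_pi, Nat.card_pi]
  refine Finset.prod_congr rfl fun i _ => ?_
  have hd : finrank k ((Fin (e i) → k) × (Fin (d i) → k)) = finrank k (Fin (n i) → k) := by
    simp [h, add_comm]
  let θ := LinearEquiv.ofFinrankEq _ _ hd
  rw [← card_linearEquiv_self]
  exact Nat.card_congr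
    ⟨fun h => θ.symm.trans h, fun h => θ.trans h, fun h => by ext : 1; simp,
      fun h => by ext : 1; simp⟩

theorem card_framing_fiber (θ : Framing k d e n) :
    Nat.card {η : Framing k d e n // η.sub = θ.sub} =
      Nat.card (∀ i, GL (Fin (e i)) k) * (Nat.card (∀ i, GL (Fin (d i)) k) *
        Fintype.card k ^ (∑ i, e i * d i)) := by
  have hc : Nat.card {η : Framing k d e n // η.sub = θ.sub} = Nat.card (∀ i,
      {η : ((Fin (e i) → k) × (Fin (d i) → k)) ≃ₗ[k] (Fin (n i) → k) //
        (LinearMap.range (LinearMap.inr k (Fin (e i) → k) (Fin (d i) → k))).map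
          η.toLinearMap = θ.sub i}) :=
    Nat.card_congr ((Equiv.subtypeEquivRight fun η => funext_iff).trans
      (Equiv.subtypePiEquivPi (p := fun i (η : ((Fin (e i) → k) × (Fin (d i) → k)) ≃ₗ[k]
        (Fin (n i) → k)) => (LinearMap.range (LinearMap.inr k (Fin (e i) → k)
          (Fin (d i) → k))).map η.toLinearMap = θ.sub i)))
  rw [hc, Nat.card_pi, Nat.card_pi, Nat.card_pi, ← Finset.prod_pow_eq_pow_sum,
    ← Finset.prod_mul_distrib, ← Finset.prod_mul_distrib]
  refine Finset.prod_congr rfl fun i _ => ?_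
  rw [card_linearEquiv_map_range_inr (W := θ.sub i) (θ i) rfl, card_linearEquiv_self,
    card_linearEquiv_self,
    Nat.card_congr LinearMap.toMatrix'.toEquiv, Matrix, Nat.card_fun, Nat.card_fun]
  simp [← pow_mul]

end Representations

/-- The evaluation map is a twisted character of the Hall algebra: for
`G`-invariant homogeneous `f` of degree `d` and `g` of degree `e`,
`ev(f * g) = v^{-⟨e,d⟩} ev(f) ev(g)`. -/
theorem stmt13 {st tg : Ar → I} (v : ℝ) (hv : 0 < v)
    (hv2 : v ^ 2 = (Fintype.card k : ℝ))
    (d e : I → ℕ) (f g : HallAlg k st tg)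
    (hfhom : ∀ d' : I → ℕ, d' ≠ d → f d' = 0)
    (hghom : ∀ d' : I → ℕ, d' ≠ e → g d' = 0)
    (hfinvar : ∀ (gg : ∀ i, GL (Fin (d i)) k) (Y : RepOf k st tg d),
      f d (gAct gg Y) = f d Y)
    (hginvar : ∀ (gg : ∀ i, GL (Fin (e i)) k) (Y : RepOf k st tg e),
      g e (gAct gg Y) = g e Y) :
    evHall (d + e) (hallMul v f g) =
      (v : ℂ) ^ (-(eulerForm st tg e d)) * (evHall d f * evHall e g) := by
  classical
  have : ∀ i, Finite (Submodule k (Fin ((d + e) i) → k)) := fun i =>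
    Finite.of_injective _ SetLike.coe_injective
  have : ∀ i, Finite (((Fin (e i) → k) × (Fin (d i) → k)) ≃ₗ[k] (Fin ((d + e) i) → k)) :=
    fun i => finite_linearEquiv
  have := Fintype.ofFinite (∀ i, Submodule k (Fin ((d + e) i) → k))
  have := Fintype.ofFinite (Framing k d e (d + e))
  have hv0 : (v : ℂ) ≠ 0 := by exact_mod_cast hv.ne'
  have hq : (Fintype.card k : ℂ) = (v : ℂ) ^ 2 := by exact_mod_cast hv2.symm
  set F : (∀ i, Submodule k (Fin ((d + e) i) → k)) → ℂ := fun U =>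
    ∑ᶠ X : {X : RepOf k st tg (d + e) // IsSub X U}, hallTerm v f g X.1 U X.2 with hF
  set c : ℂ := (Nat.card (∀ i, GL (Fin (e i)) k) : ℂ) * (Nat.card (∀ i, GL (Fin (d i)) k) *
    (Fintype.card k : ℂ) ^ (∑ i, e i * d i)) with hc
  have hswap : ∑ X, hallMul v f g (d + e) X = ∑ U, F U := by
    have h1 : ∀ X, hallMul v f g (d + e) X =
        ∑ U, if h : IsSub X U then hallTerm v f g X U h else 0 := fun X =>
      finsum_subtype_eq_sum_dite (IsSub X) fun U h => hallTerm v f g X U h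
    rw [Finset.sum_congr rfl fun X _ => h1 X, Finset.sum_comm]
    exact Finset.sum_congr rfl fun U _ =>
      (finsum_subtype_eq_sum_dite (fun X => IsSub X U) fun X h => hallTerm v f g X U h).symm
  have hfib : ∀ U, c * F U = ∑ θ : {θ : Framing k d e (d + e) // θ.sub = U}, F θ.1.sub := by
    intro U
    by_cases hU : ∃ θ : Framing k d e (d + e), θ.sub = U
    · obtain ⟨θ, rfl⟩ := hU
      rw [Finset.sum_congr rfl fun η _ => congrArg F η.2, Finset.sum_const, Finset.card_univ,
        ← Nat.card_eq_fintype_card, card_framing_fiber, nsmul_eq_mul, hc]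
      push_cast
      rfl
    · have hFU : F U = 0 := by
        rw [hF]
        refine finsum_eq_zero_of_forall_eq_zero fun X => ?_
        by_contra h
        exact hU (exists_framing_of_hallTerm_ne_zero hfhom hghom h)
      have : IsEmpty {θ : Framing k d e (d + e) // θ.sub = U} := ⟨fun θ => hU ⟨θ.1, θ.2⟩⟩
      rw [hFU, mul_zero, Finset.univ_eq_empty, Finset.sum_empty]
  have htot : c * ∑ U, F U = Nat.card (∀ i, GL (Fin ((d + e) i)) k) *
      ((v : ℂ) ^ eulerForm st tg e d * ((Fintype.card k : ℂ) ^ (∑ a, e (st a) * d (tg a)) *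
          ((∑ Y, f d Y) * ∑ Z, g e Z))) := by
    rw [Finset.mul_sum, Finset.sum_congr rfl fun U _ => hfib U,
      Fintype.sum_fiberwise (fun θ : Framing k d e (d + e) => θ.sub) (fun θ => F θ.sub)]
    simp only [hF, sum_hallTerm_framing v hfinvar hginvar]
    rw [Finset.sum_const, Finset.card_univ, ← Nat.card_eq_fintype_card, card_framing rfl,
      nsmul_eq_mul]
  have hG : ∀ m : I → ℕ, (Nat.card (∀ i, GL (Fin (m i)) k) : ℂ) ≠ 0 := fun m =>
    Nat.cast_ne_zero.mpr Nat.card_pos.ne'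
  have hpow : (v : ℂ) ^ eulerForm st tg e d * (Fintype.card k : ℂ) ^ (∑ a, e (st a) * d (tg a)) =
      (v : ℂ) ^ (-eulerForm st tg e d) * (Fintype.card k : ℂ) ^ (∑ i, e i * d i) := by
    rw [hq, ← pow_mul, ← pow_mul, ← zpow_natCast, ← zpow_natCast, ← zpow_add₀ hv0,
      ← zpow_add₀ hv0]
    congr 1
    simp only [eulerForm]
    push_cast
    ring
  have hqe : (Fintype.card k : ℂ) ^ (∑ i, e i * d i) ≠ 0 := by rw [hq]; positivity
  rw [evHall, evHall, evHall, hswap]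
  have hG0 := hG (d + e)
  have hGd := hG d
  have hGe := hG e
  have hc0 : c ≠ 0 := mul_ne_zero hGe (mul_ne_zero hGd hqe)
  apply mul_left_cancel₀ hc0
  rw [mul_left_comm, htot, inv_mul_cancel_left₀ hG0, ← mul_assoc, hpow, hc]
  field_simp
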